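/- arXiv:math/0510155 — 2 statements merged into one kernel-verified Lean document; each statement's English description precedes it below -/
import Mathlib

section
/- For every n ≥ 1, F₁₁₁₁(n) = Σ_{k=0}^∞ Σ_{l=0}^∞ 2^{-(k+l+2)} · C(kl, n), where C(kl, n) is the binomial coefficient. -/
open scoped BigOperators

/-- A zero-one matrix (entries in `Bool`) with no zero rows and no zero columns. -/
def IsIncidence {k l : ℕ} (M : Matrix (Fin k) (Fin l) Bool) : Prop :=
  (∀ i, ∃ j, M i j = true) ∧ (∀ j, ∃ i, M i j = true)

/-- The number of entries equal to one in a zero-one matrix. -/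
def numOnes {k l : ℕ} (M : Matrix (Fin k) (Fin l) Bool) : ℕ :=
  (Finset.univ.filter fun p : Fin k × Fin l => M p.1 p.2 = true).card

/-- `F₁₁₁₁ n`: the number of incidence matrices (of any size) with exactly `n` ones. -/
noncomputable def F1111 (n : ℕ) : ℕ :=
  Nat.card {A : Σ k l : ℕ, Matrix (Fin k) (Fin l) Bool //
    IsIncidence A.2.2 ∧ numOnes A.2.2 = n}

noncomputable def mIJ (i j n : ℕ) : ℕ :=
  Nat.card {M : Matrix (Fin i) (Fin j) Bool // IsIncidence M ∧ numOnes M = n}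

/-- total preorders on `Fin n` -/
noncomputable def numPreorders (n : ℕ) : ℕ :=
  Nat.card {R : Fin n → Fin n → Prop //
    (∀ x, R x x) ∧ (∀ x y z, R x y → R y z → R x z) ∧ (∀ x y, R x y ∨ x = y ∨ R y x)}

noncomputable def numPreordersWithBlocks (n k : ℕ) : ℕ :=
  Nat.card {R : Fin n → Fin n → Prop //
    ((∀ x, R x x) ∧ (∀ x y z, R x y → R y z → R x z) ∧ (∀ x y, R x y ∨ x = y ∨ R y x)) ∧
    Nat.card (Quot fun x y => R x y ∧ R y x) = k}

noncomputable def S11 (n : ℕ) : ℕ :=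
  Nat.card {A : Σ k : ℕ, Matrix (Fin k) (Fin k) Bool //
    (∀ i j, A.2 i j = A.2 j i) ∧ IsIncidence A.2 ∧ numOnes A.2 = n}

def trSigma : (Σ k l : ℕ, Matrix (Fin k) (Fin l) Bool) → (Σ k l : ℕ, Matrix (Fin k) (Fin l) Bool) :=
  fun A => ⟨A.2.1, A.1, A.2.2.transpose⟩

noncomputable def Phi11 (n : ℕ) : ℕ :=
  Nat.card (Quot fun x y : {A : Σ k l : ℕ, Matrix (Fin k) (Fin l) Bool //
    IsIncidence A.2.2 ∧ numOnes A.2.2 = n} => trSigma x.1 = y.1)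

noncomputable def F1011 (n : ℕ) : ℕ :=
  Nat.card {A : Σ k l : ℕ, Matrix (Fin k) (Fin l) Bool //
    IsIncidence A.2.2 ∧ numOnes A.2.2 = n ∧
    ∀ i i' : Fin A.1, (∀ j, A.2.2 i j = A.2.2 i' j) → i = i'}

noncomputable def F0001 (n : ℕ) : ℕ :=
  Nat.card (Quot fun x y : {A : Σ k l : ℕ, Matrix (Fin k) (Fin l) Bool //
      IsIncidence A.2.2 ∧ numOnes A.2.2 = n ∧
      ∀ i i' : Fin A.1, (∀ j, A.2.2 i j = A.2.2 i' j) → i = i'} =>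
    ∃ σ : Equiv.Perm (Fin x.1.1), ∃ τ : Equiv.Perm (Fin x.1.2.1),
      y.1 = ⟨x.1.1, x.1.2.1, Matrix.of fun i j => x.1.2.2 (σ i) (τ j)⟩)

noncomputable def numInvolutions (n : ℕ) : ℕ :=
  Nat.card {σ : Equiv.Perm (Fin n) // σ * σ = 1}

/-- number of cycles of a permutation, counting fixed points as cycles -/
def numCycles {n : ℕ} (σ : Equiv.Perm (Fin n)) : ℕ :=
  Multiset.card σ.cycleType + (n - σ.support.card)

/-- unsigned Stirling number of the first kind: permutations of `n` with `k` cycles -/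
noncomputable def stirling1Unsigned (n k : ℕ) : ℕ :=
  Nat.card {σ : Equiv.Perm (Fin n) // numCycles σ = k}

/-- Stirling number of the second kind: partitions of an `n`-set into `k` blocks -/
noncomputable def stirling2 (n k : ℕ) : ℕ :=
  Nat.card {c : Setoid (Fin n) // Nat.card (Quotient c) = k}

noncomputable def sSym (k n : ℕ) : ℕ :=
  Nat.card {M : Matrix (Fin k) (Fin k) Bool // (∀ a b, M a b = M b a) ∧ numOnes M = n}

noncomputable def muSym (i n : ℕ) : ℕ :=
  Nat.card {M : Matrix (Fin i) (Fin i) Bool //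
    (∀ a b, M a b = M b a) ∧ IsIncidence M ∧ numOnes M = n}

open Finset

lemma IsIncidence.card_rows_le {k l : ℕ} {M : Matrix (Fin k) (Fin l) Bool} (hM : IsIncidence M) :
    k ≤ numOnes M := by
  have h : (univ : Finset (Fin k)) ⊆
      (univ.filter fun p : Fin k × Fin l => M p.1 p.2 = true).image Prod.fst := fun i _ => by
    obtain ⟨j, hj⟩ := hM.1 i
    exact mem_image.2 ⟨(i, j), by simpa using hj, rfl⟩
  simpa [numOnes] using (card_le_card h).trans card_image_le

lemma IsIncidence.card_cols_le {k l : ℕ} {M : Matrix (Fin k) (Fin l) Bool} (hM : IsIncidence M) :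
    l ≤ numOnes M := by
  have h : (univ : Finset (Fin l)) ⊆
      (univ.filter fun p : Fin k × Fin l => M p.1 p.2 = true).image Prod.snd := fun j _ => by
    obtain ⟨i, hi⟩ := hM.2 j
    exact mem_image.2 ⟨(i, j), by simpa using hi, rfl⟩
  simpa [numOnes] using (card_le_card h).trans card_image_le

lemma mIJ_eq_zero_of_lt_left {i n : ℕ} (j : ℕ) (h : n < i) : mIJ i j n = 0 := by
  have : IsEmpty {M : Matrix (Fin i) (Fin j) Bool // IsIncidence M ∧ numOnes M = n} :=
    ⟨fun M => by have := M.2.1.card_rows_le; have := M.2.2; omega⟩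
  exact Nat.card_of_isEmpty

lemma mIJ_eq_zero_of_lt_right {j n : ℕ} (i : ℕ) (h : n < j) : mIJ i j n = 0 := by
  have : IsEmpty {M : Matrix (Fin i) (Fin j) Bool // IsIncidence M ∧ numOnes M = n} :=
    ⟨fun M => by have := M.2.1.card_cols_le; have := M.2.2; omega⟩
  exact Nat.card_of_isEmpty

/-- Incidence matrices with `n` ones, sorted by their (bounded) dimensions. -/
def incidenceEquivSigma (n : ℕ) :
    {A : Σ k l : ℕ, Matrix (Fin k) (Fin l) Bool // IsIncidence A.2.2 ∧ numOnes A.2.2 = n} ≃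
      Σ i : Fin (n + 1), Σ j : Fin (n + 1),
        {M : Matrix (Fin i) (Fin j) Bool // IsIncidence M ∧ numOnes M = n} where
  toFun A := ⟨⟨A.1.1, Nat.lt_succ_of_le (A.2.1.card_rows_le.trans A.2.2.le)⟩,
    ⟨A.1.2.1, Nat.lt_succ_of_le (A.2.1.card_cols_le.trans A.2.2.le)⟩, ⟨A.1.2.2, A.2⟩⟩
  invFun B := ⟨⟨B.1, B.2.1, B.2.2.1⟩, B.2.2.2⟩
  left_inv _ := rfl
  right_inv _ := rfl

lemma F1111_eq_sum_mIJ (n : ℕ) :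
    F1111 n = ∑ i ∈ range (n + 1), ∑ j ∈ range (n + 1), mIJ i j n := by
  rw [F1111, Nat.card_congr (incidenceEquivSigma n), Nat.card_sigma, Finset.sum_range]
  refine sum_congr rfl fun i _ => ?_
  rw [Nat.card_sigma, Finset.sum_range]
  rfl

/-- The finite sets of `n` cells whose sets of occupied rows and columns are `S` and `T`
correspond to incidence matrices of size `#S × #T` with `n` ones. -/
lemma card_filter_image_eq_mIJ {α β : Type*} [Fintype α] [LinearOrder α] [Fintype β]
    [LinearOrder β] (n : ℕ) (S : Finset α) (T : Finset β) :
    #{P ∈ powersetCard n (univ : Finset (α × β)) | (P.image Prod.fst, P.image Prod.snd) = (S, T)} =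
      mIJ #S #T n := by
  set e := S.orderEmbOfFin rfl
  set f := T.orderEmbOfFin rfl
  have he : ∀ x, x ∈ S ↔ ∃ a, e a = x := fun x => by
    rw [← mem_coe, ← S.range_orderEmbOfFin rfl]; rfl
  have hf : ∀ y, y ∈ T ↔ ∃ b, f b = y := fun y => by
    rw [← mem_coe, ← T.range_orderEmbOfFin rfl]; rfl
  let ef : Fin #S × Fin #T ↪ α × β := e.toEmbedding.prodMap f.toEmbedding
  classical
  rw [mIJ, Nat.card_eq_fintype_card, Fintype.card_subtype]
  symm
  refine card_bij (fun M _ => (univ.filter fun p : Fin #S × Fin #T => M p.1 p.2 = true).map ef)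
    ?_ ?_ ?_
  · intro M hM
    obtain ⟨⟨hr, hc⟩, hn⟩ := (mem_filter.1 hM).2
    rw [mem_filter, mem_powersetCard, card_map, Prod.mk.injEq]
    refine ⟨⟨subset_univ _, hn⟩, ?_, ?_⟩
    · ext x
      simp only [mem_image, mem_map, mem_filter, mem_univ, true_and, he]
      constructor
      · rintro ⟨_, ⟨p, -, rfl⟩, rfl⟩
        exact ⟨p.1, rfl⟩
      · rintro ⟨a, rfl⟩
        obtain ⟨b, hb⟩ := hr a
        exact ⟨_, ⟨(a, b), hb, rfl⟩, rfl⟩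
    · ext y
      simp only [mem_image, mem_map, mem_filter, mem_univ, true_and, hf]
      constructor
      · rintro ⟨_, ⟨p, -, rfl⟩, rfl⟩
        exact ⟨p.2, rfl⟩
      · rintro ⟨b, rfl⟩
        obtain ⟨a, ha⟩ := hc b
        exact ⟨_, ⟨(a, b), ha, rfl⟩, rfl⟩
  · intro M _ N _ h
    have h := map_injective ef h
    ext a b
    have hab := Finset.ext_iff.1 h (a, b)
    simp only [mem_filter, mem_univ, true_and] at hab
    exact Bool.eq_iff_iff.2 hab
  · intro P hP
    rw [mem_filter, mem_powersetCard, Prod.mk.injEq] at hP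
    obtain ⟨⟨-, hn⟩, hS, hT⟩ := hP
    let M : Matrix (Fin #S) (Fin #T) Bool := fun a b => decide (ef (a, b) ∈ P)
    have hMP : (univ.filter fun p : Fin #S × Fin #T => M p.1 p.2 = true).map ef = P := by
      ext q
      simp only [mem_map, mem_filter, mem_univ, true_and, M, decide_eq_true_eq]
      constructor
      · rintro ⟨p, hp, rfl⟩
        exact hp
      · intro hq
        obtain ⟨a, ha⟩ := (he q.1).1 (hS ▸ mem_image_of_mem _ hq)
        obtain ⟨b, hb⟩ := (hf q.2).1 (hT ▸ mem_image_of_mem _ hq)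
        have hab : ef (a, b) = q := Prod.ext ha hb
        exact ⟨(a, b), by rwa [hab], hab⟩
    refine ⟨M, mem_filter.2 ⟨mem_univ _, ⟨fun a => ?_, fun b => ?_⟩, ?_⟩, hMP⟩
    · have ha : e a ∈ P.image Prod.fst := hS ▸ (he _).2 ⟨a, rfl⟩
      obtain ⟨q, hq, hqa⟩ := mem_image.1 ha
      obtain ⟨b, hb⟩ := (hf q.2).1 (hT ▸ mem_image_of_mem _ hq)
      have hab : ef (a, b) = q := Prod.ext hqa.symm hb
      exact ⟨b, by simpa [M, hab] using hq⟩
    · have hb : f b ∈ P.image Prod.snd := hT ▸ (hf _).2 ⟨b, rfl⟩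
      obtain ⟨q, hq, hqb⟩ := mem_image.1 hb
      obtain ⟨a, ha⟩ := (he q.1).1 (hS ▸ mem_image_of_mem _ hq)
      have hab : ef (a, b) = q := Prod.ext ha hqb.symm
      exact ⟨a, by simpa [M, hab] using hq⟩
    · rw [numOnes, ← card_map ef, hMP, hn]

lemma sum_choose_mul_eq_of_support (k n : ℕ) (g : ℕ → ℕ) (hg : ∀ i, n < i → g i = 0) :
    ∑ i ∈ range (k + 1), k.choose i * g i = ∑ i ∈ range (n + 1), k.choose i * g i := by
  rcases le_total k n with h | h
  · refine sum_subset (range_mono (by omega)) fun i _ hi => ?_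
    rw [Nat.choose_eq_zero_of_lt (by simpa using hi), zero_mul]
  · refine (sum_subset (range_mono (by omega)) fun i _ hi => ?_).symm
    rw [hg i (by simpa using hi), mul_zero]

lemma choose_mul_eq_sum_mIJ (k l n : ℕ) :
    (k * l).choose n =
      ∑ i ∈ range (n + 1), ∑ j ∈ range (n + 1), k.choose i * (l.choose j * mIJ i j n) := by
  have hcard : (k * l).choose n = #(powersetCard n (univ : Finset (Fin k × Fin l))) := by simp
  rw [hcard, card_eq_sum_card_fiberwise
    (f := fun P => (P.image Prod.fst, P.image Prod.snd)) (t := univ) (fun _ _ => by simp)]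
  simp only [card_filter_image_eq_mIJ]
  rw [← univ_product_univ, sum_product, ← powerset_univ, ← powerset_univ]
  have hcol : ∀ i, ∑ T ∈ (univ : Finset (Fin l)).powerset, mIJ i #T n =
      ∑ j ∈ range (l + 1), l.choose j * mIJ i j n := fun i => by
    simp [sum_powerset_apply_card (fun j => mIJ i j n), -powerset_univ]
  simp only [hcol]
  rw [sum_powerset_apply_card (fun i => ∑ j ∈ range (l + 1), l.choose j * mIJ i j n)]
  simp only [card_univ, Fintype.card_fin, smul_eq_mul]
  rw [sum_choose_mul_eq_of_support k n _ fun i hi => sum_eq_zero fun j _ => by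
    rw [mIJ_eq_zero_of_lt_left j hi, mul_zero]]
  refine sum_congr rfl fun i _ => ?_
  rw [sum_choose_mul_eq_of_support l n _ fun j hj => mIJ_eq_zero_of_lt_right i hj, mul_sum]

lemma hasSum_choose_div_two_pow (i : ℕ) :
    HasSum (fun k : ℕ => (k.choose i : ℝ) / 2 ^ (k + 1)) 1 := by
  rw [← hasSum_nat_add_iff' i, sum_eq_zero fun k hk => by
    rw [Nat.choose_eq_zero_of_lt (mem_range.1 hk)]; simp, sub_zero]
  have h := (hasSum_choose_mul_geometric_of_norm_lt_one i
    (show ‖(1 / 2 : ℝ)‖ < 1 by norm_num)).mul_left ((1 / 2 : ℝ) ^ (i + 1))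
  rw [show (1 / 2 : ℝ) ^ (i + 1) * (1 / (1 - 1 / 2) ^ (i + 1)) = 1 by norm_num] at h
  refine h.congr_fun fun k => ?_
  rw [div_eq_mul_one_div, ← one_div_pow, show k + i + 1 = i + 1 + k by ring, pow_add]
  ring

/-- `F₁₁₁₁(n) = Σ_{k,l≥0} 2^{-(k+l+2)} C(kl, n)` for `n ≥ 1`. -/
theorem F1111_eq_tsum (n : ℕ) (hn : 1 ≤ n) :
    (F1111 n : ℝ) =
      ∑' k : ℕ, ∑' l : ℕ, (1 / 2 ^ (k + l + 2)) * ((k * l).choose n : ℝ) := by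
  have hterm : ∀ k l : ℕ, (1 / 2 ^ (k + l + 2)) * ((k * l).choose n : ℝ) =
      ∑ i ∈ range (n + 1), ∑ j ∈ range (n + 1),
        (k.choose i : ℝ) / 2 ^ (k + 1) * (mIJ i j n * ((l.choose j : ℝ) / 2 ^ (l + 1))) := by
    intro k l
    rw [choose_mul_eq_sum_mIJ]
    push_cast
    simp only [mul_sum]
    refine sum_congr rfl fun i _ => sum_congr rfl fun j _ => ?_
    rw [show k + l + 2 = (k + 1) + (l + 1) by ring, pow_add]
    field_simp
  have hinner : ∀ k : ℕ, ∑' l : ℕ, (1 / 2 ^ (k + l + 2)) * ((k * l).choose n : ℝ) =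
      ∑ i ∈ range (n + 1), ∑ j ∈ range (n + 1),
        (k.choose i : ℝ) / 2 ^ (k + 1) * (mIJ i j n * 1) := by
    intro k
    simp only [hterm]
    exact (hasSum_sum fun i _ => hasSum_sum fun j _ =>
      ((hasSum_choose_div_two_pow j).mul_left _).mul_left _).tsum_eq
  simp only [hinner]
  rw [(hasSum_sum fun i _ => hasSum_sum fun j _ =>
    (hasSum_choose_div_two_pow i).mul_right _).tsum_eq, F1111_eq_sum_mIJ]
  simp
end

section
/- F₁₀₁₁(n) = o(F₁₁₁₁(n)) as n → ∞, i.e. lim_{n→∞} F₁₀₁₁(n)/F₁₁₁₁(n) = 0. -/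
open scoped BigOperators

section WeakOrder

variable {α : Type*}

/-- A transitive and total relation. -/
def IsWeakOrder (R : α → α → Prop) : Prop :=
  (∀ x y z, R x y → R y z → R x z) ∧ ∀ x y, R x y ∨ R y x

/-- The class of `x` under the symmetric part of `R` is `{x}`. -/
def Alone (R : α → α → Prop) (x : α) : Prop :=
  ∀ y, R x y → R y x → y = x

/-- Pairs of weak orders whose symmetric parts intersect trivially. They encode incidence matrices
whose ones are labelled: the classes of the two orders are the rows and the columns. -/
def IsLabelledIncidence (p : (α → α → Prop) × (α → α → Prop)) : Prop :=
  IsWeakOrder p.1 ∧ IsWeakOrder p.2 ∧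
    ∀ x y, p.1 x y → p.1 y x → p.2 x y → p.2 y x → x = y

/-- No two rows of weight one have their entry in the same column. -/
def DistinctUnitRows (p : (α → α → Prop) × (α → α → Prop)) : Prop :=
  ∀ x y, Alone p.1 x → Alone p.1 y → p.2 x y → p.2 y x → x = y

/-- Two weak orders which agree away from `x` and have the same lower set below `x` coincide, if
`x` shares its class with another element in both. -/
lemma IsWeakOrder.eq_of_not_alone {R S : α → α → Prop} (hR : IsWeakOrder R) (hS : IsWeakOrder S)
    {x : α} (hxR : ¬ Alone R x) (hxS : ¬ Alone S x)
    (h : ∀ u v, u ≠ x → v ≠ x → (R u v ↔ S u v)) (hx : ∀ u, u ≠ x → (R u x ↔ S u x)) :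
    R = S := by
  obtain ⟨Rt, Rl⟩ := hR
  obtain ⟨St, Sl⟩ := hS
  simp only [Alone, not_forall] at hxR hxS
  obtain ⟨y, hy1, hy2, hy⟩ := hxR
  obtain ⟨z, hz1, hz2, hz⟩ := hxS
  have hRx : R x x := by simpa using Rl x x
  have hSx : S x x := by simpa using Sl x x
  have hzy : S z y := (h z y hz hy).1 (Rt _ _ _ ((hx z hz).2 hz2) hy1)
  have hyz : R y z := (h y z hy hz).2 (St _ _ _ ((hx y hy).1 hy2) hz1)
  funext u v
  apply propext
  by_cases hv : v = x
  · subst hv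
    by_cases hu : u = v
    · subst hu; simp [hRx, hSx]
    · exact hx u hu
  by_cases hu : u = x
  · subst hu
    constructor
    · intro H
      exact St _ _ _ hz1 (St _ _ _ hzy ((h y v hy hv).1 (Rt _ _ _ hy2 H)))
    · intro H
      exact Rt _ _ _ hy1 (Rt _ _ _ hyz ((h z v hz hv).2 (St _ _ _ hz2 H)))
  · exact h u v hu hv

/-- Two weak orders which agree away from `x` and have the same lower set below `x` coincide, if
`x` is alone in its class in both. -/
lemma IsWeakOrder.eq_of_alone {R S : α → α → Prop} (hR : IsWeakOrder R) (hS : IsWeakOrder S)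
    {x : α} (hxR : Alone R x) (hxS : Alone S x)
    (h : ∀ u v, u ≠ x → v ≠ x → (R u v ↔ S u v)) (hx : ∀ u, u ≠ x → (R u x ↔ S u x)) :
    R = S := by
  have key : ∀ {T : α → α → Prop}, IsWeakOrder T → Alone T x → ∀ v, v ≠ x → (T x v ↔ ¬ T v x) :=
    fun hT ha v hv => ⟨fun h1 h2 => hv (ha v h1 h2), fun h1 => (hT.2 x v).resolve_right h1⟩
  have hRx : R x x := by simpa using hR.2 x x
  have hSx : S x x := by simpa using hS.2 x x
  funext u v
  apply propext
  by_cases hv : v = x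
  · subst hv
    by_cases hu : u = v
    · subst hu; simp [hRx, hSx]
    · exact hx u hu
  by_cases hu : u = x
  · subst hu
    rw [key hR hxR v hv, key hS hxS v hv, hx v hv]
  · exact h u v hu hv

/-- Move `x` out of its class into a new class of its own, immediately above the old one. -/
def detach (R : α → α → Prop) (x : α) : α → α → Prop :=
  fun u v => R u v ∧ (u = x → v = x ∨ ¬ R v x)

lemma IsWeakOrder.detach {R : α → α → Prop} (hR : IsWeakOrder R) (x : α) :
    IsWeakOrder (detach R x) := by
  obtain ⟨ht, hl⟩ := hR
  refine ⟨?_, ?_⟩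
  · rintro u v w ⟨h1, h2⟩ ⟨h3, h4⟩
    refine ⟨ht _ _ _ h1 h3, ?_⟩
    rintro rfl
    rcases h2 rfl with rfl | h2
    · exact h4 rfl
    · exact Or.inr fun h => h2 (ht _ _ _ h3 h)
  · intro u v
    have := hl u v
    have := hl u u
    simp only [_root_.detach]
    grind

lemma alone_detach (R : α → α → Prop) (x : α) : Alone (detach R x) x := by
  rintro y ⟨_, h1⟩ ⟨h2, _⟩
  exact (h1 rfl).resolve_right (not_not.2 h2)

lemma detach_injective {R S : α → α → Prop} (hR : IsWeakOrder R) (hS : IsWeakOrder S)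
    {x : α} (hxR : ¬ Alone R x) (hxS : ¬ Alone S x) (h : detach R x = detach S x) : R = S := by
  have h' : ∀ u v, u ≠ x → (R u v ↔ S u v) := by
    intro u v hu
    have := congrFun (congrFun h u) v
    simpa [detach, hu] using this
  exact hR.eq_of_not_alone hS hxR hxS (fun u v hu _ => h' u v hu) (fun u hu => h' u x hu)

/-- Move `x` into the class of `y`. -/
def attachTo [DecidableEq α] (S : α → α → Prop) (x y : α) : α → α → Prop :=
  fun u v => S (if u = x then y else u) (if v = x then y else v)

lemma IsWeakOrder.attachTo [DecidableEq α] {S : α → α → Prop} (hS : IsWeakOrder S) (x y : α) :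
    IsWeakOrder (attachTo S x y) :=
  ⟨fun _ _ _ h1 h2 => hS.1 _ _ _ h1 h2, fun _ _ => hS.2 _ _⟩

end WeakOrder

section Counting

open Finset Classical

variable {n : ℕ}

noncomputable def singles (R : Fin n → Fin n → Prop) : Finset (Fin n) :=
  univ.filter (Alone R)

lemma mem_singles {R : Fin n → Fin n → Prop} {x : Fin n} : x ∈ singles R ↔ Alone R x := by
  simp [singles]

noncomputable def labelled (n : ℕ) :
    Finset ((Fin n → Fin n → Prop) × (Fin n → Fin n → Prop)) :=
  univ.filter IsLabelledIncidence

lemma mem_labelled {p : (Fin n → Fin n → Prop) × (Fin n → Fin n → Prop)} :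
    p ∈ labelled n ↔ IsLabelledIncidence p := by
  simp [labelled]

lemma card_singles_detach_le {R : Fin n → Fin n → Prop} (hR : IsWeakOrder R) {x : Fin n}
    (hx : ¬ Alone R x) : (singles (detach R x)).card ≤ (singles R).card + 2 := by
  simp only [Alone, not_forall] at hx
  obtain ⟨y, hy1, hy2, hy⟩ := hx
  have hsub : singles (detach R x) ⊆ insert x (insert y (singles R)) := by
    intro z hz
    rw [mem_singles] at hz
    simp only [mem_insert, mem_singles]
    by_contra! hcon
    obtain ⟨hzx, hzy, hz'⟩ := hcon
    apply hz'
    intro w hw1 hw2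
    by_cases hwx : w = x
    · subst hwx
      exact absurd (hz y ⟨hR.1 _ _ _ hw1 hy1, fun h => absurd h hzx⟩
        ⟨hR.1 _ _ _ hy2 hw2, fun h => absurd h hy⟩) (Ne.symm hzy)
    · exact hz w ⟨hw1, fun h => absurd h hzx⟩ ⟨hw2, fun h => absurd h hwx⟩
  calc _ ≤ _ := card_le_card hsub
    _ ≤ _ := card_insert_le _ _
    _ ≤ _ := by have := card_insert_le y (singles R); omega

lemma card_few_singles_mul_le (n b : ℕ) :
    ((labelled n).filter fun p => (singles p.1).card ≤ b).card * (n - b) ≤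
      (labelled n).card * (b + 2) := by
  set A := (labelled n).filter fun p => (singles p.1).card ≤ b
  set B := (labelled n).filter fun p => (singles p.1).card ≤ b + 2
  have h1 : A.card * (n - b) ≤ (A.sigma fun p => (singles p.1)ᶜ).card := by
    rw [card_sigma, ← smul_eq_mul]
    apply card_nsmul_le_sum
    intro p hp
    have := (mem_filter.1 hp).2
    rw [card_compl, Fintype.card_fin]
    omega
  have h2 : (B.sigma fun p => singles p.1).card ≤ B.card * (b + 2) := by
    rw [card_sigma, ← smul_eq_mul]
    apply sum_le_card_nsmul
    intro p hp
    exact (mem_filter.1 hp).2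
  have h3 : (A.sigma fun p => (singles p.1)ᶜ).card ≤ (B.sigma fun p => singles p.1).card := by
    apply card_le_card_of_injOn (fun q => ⟨(detach q.1.1 q.2, q.1.2), q.2⟩)
    · rintro ⟨⟨R, S⟩, x⟩ hq
      simp only [coe_sigma, Set.mem_sigma_iff, mem_coe, A, B, mem_filter, mem_labelled,
        mem_compl, mem_singles] at hq ⊢
      obtain ⟨⟨⟨hR, hS, hRS⟩, hb⟩, hx⟩ := hq
      refine ⟨⟨⟨hR.detach x, hS, fun u v h1 h2 => hRS u v h1.1 h2.1⟩, ?_⟩, alone_detach R x⟩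
      exact (card_singles_detach_le hR hx).trans (by simpa using hb)
    · rintro ⟨⟨R, S⟩, x⟩ hq ⟨⟨R', S'⟩, x'⟩ hq' h
      simp only [coe_sigma, Set.mem_sigma_iff, mem_coe, A, mem_filter, mem_labelled,
        mem_compl, mem_singles] at hq hq'
      simp only [Sigma.mk.injEq, Prod.mk.injEq, heq_eq_eq] at h
      obtain ⟨⟨h1, rfl⟩, rfl⟩ := h
      have := detach_injective hq.1.1.1 hq'.1.1.1 hq.2 hq'.2 h1
      simp only at this
      rw [this]
  calc _ ≤ _ := h1
    _ ≤ _ := h3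
    _ ≤ _ := h2
    _ ≤ _ := Nat.mul_le_mul_right _ (card_le_card (filter_subset _ _))

/-- The number of elements other than `x` which are at most `x`. -/
noncomputable def height (S : Fin n → Fin n → Prop) (x : Fin n) : ℕ :=
  (univ.filter fun u => u ≠ x ∧ S u x).card

lemma height_lt (S : Fin n → Fin n → Prop) (x : Fin n) : height S x < n := by
  have : height S x < (univ : Finset (Fin n)).card := by
    apply card_lt_card
    rw [ssubset_univ_iff]
    intro h
    have := h ▸ mem_univ x
    simp at this
  simpa using this

lemma lower_eq_of_height_eq {S T : Fin n → Fin n → Prop} (hS : IsWeakOrder S)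
    (hT : IsWeakOrder T) {x : Fin n} (h : ∀ u v, u ≠ x → v ≠ x → (S u v ↔ T u v))
    (hh : height S x = height T x) (u : Fin n) (hu : u ≠ x) : S u x ↔ T u x := by
  have key : (univ.filter fun u => u ≠ x ∧ S u x) = (univ.filter fun u => u ≠ x ∧ T u x) := by
    by_cases hsub : (univ.filter fun u => u ≠ x ∧ S u x) ⊆ (univ.filter fun u => u ≠ x ∧ T u x)
    · exact eq_of_subset_of_card_le hsub hh.ge
    · symm
      refine eq_of_subset_of_card_le ?_ hh.le
      simp only [subset_iff, mem_filter, mem_univ, true_and, not_forall] at hsub ⊢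
      obtain ⟨v, ⟨hv, hSv⟩, hTv⟩ := hsub
      rintro w ⟨hw, hTw⟩
      refine ⟨hw, hS.1 _ _ _ ?_ hSv⟩
      by_contra hwv
      have hvw : T v w := (h v w hv hw).1 ((hS.2 v w).resolve_right hwv)
      exact hTv ⟨hv, hT.1 _ _ _ hvw hTw⟩
  have := Finset.ext_iff.1 key u
  simpa [hu] using this

lemma attach_injective {S T : Fin n → Fin n → Prop} (hS : IsWeakOrder S) (hT : IsWeakOrder T)
    {x y : Fin n} (h : attachTo S x y = attachTo T x y) (hh : height S x = height T x)
    (ha : Alone S x ↔ Alone T x) : S = T := by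
  have h' : ∀ u v, u ≠ x → v ≠ x → (S u v ↔ T u v) := by
    intro u v hu hv
    have := congrFun (congrFun h u) v
    simpa [attachTo, hu, hv] using this
  have hx := lower_eq_of_height_eq hS hT h' hh
  by_cases hxS : Alone S x
  · exact hS.eq_of_alone hT hxS (ha.1 hxS) h' hx
  · exact hS.eq_of_not_alone hT hxS (fun h => hxS (ha.2 h)) h' hx

/-- After attaching `x` to `y`, these are the only two rows of weight one in a common column. -/
lemma eq_or_eq_of_attach {R S : Fin n → Fin n → Prop} (hRS : DistinctUnitRows (R, S))
    {x y u v : Fin n} (hy : Alone R y) (hu : Alone R u)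
    (hv : Alone R v) (huv : u ≠ v) (h1 : attachTo S x y u v) (h2 : attachTo S x y v u) :
    (u = x ∧ v = y) ∨ (u = y ∧ v = x) := by
  simp only [attachTo] at h1 h2
  by_cases hux : u = x
  · have hvx : v ≠ x := fun h => huv (hux.trans h.symm)
    simp only [hux, hvx, if_true, if_false] at h1 h2
    exact Or.inl ⟨hux, (hRS _ _ hy hv h1 h2).symm⟩
  · by_cases hvx : v = x
    · simp only [hux, hvx, if_true, if_false] at h1 h2
      exact Or.inr ⟨hRS _ _ hu hy h1 h2, hvx⟩
    · simp only [hux, hvx, if_false] at h1 h2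
      exact absurd (hRS _ _ hu hv h1 h2) huv

lemma card_many_singles_mul_le (n b : ℕ) :
    ((labelled n).filter fun p => DistinctUnitRows p ∧ b < (singles p.1).card).card * (b * b) ≤
      (labelled n).card * (4 * n) := by
  set A := (labelled n).filter fun p => DistinctUnitRows p ∧ b < (singles p.1).card
  have h1 : A.card * (b * b) ≤ (A.sigma fun p => (singles p.1).offDiag).card := by
    rw [card_sigma, ← smul_eq_mul]
    apply card_nsmul_le_sum
    intro p hp
    have := (mem_filter.1 hp).2.2
    rw [offDiag_card]
    obtain ⟨m, hm⟩ := Nat.exists_eq_add_of_lt this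
    rw [hm]
    apply Nat.le_sub_of_add_le
    nlinarith
  have h2 : (A.sigma fun p => (singles p.1).offDiag).card ≤
      (labelled n ×ˢ (univ : Finset (Fin n × Prop × Prop))).card := by
    apply card_le_card_of_injOn (fun q => ((q.1.1, attachTo q.1.2 q.2.1 q.2.2),
      ⟨height q.1.2 q.2.1, height_lt _ _⟩, Alone q.1.2 q.2.1, q.2.1 < q.2.2))
    · rintro ⟨⟨R, S⟩, x, y⟩ hq
      simp only [coe_sigma, Set.mem_sigma_iff, mem_coe, A, mem_filter, mem_labelled,
        mem_offDiag, mem_singles, mem_product, mem_univ, and_true] at hq ⊢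
      obtain ⟨⟨⟨hR, hS, hRS⟩, hd, hb⟩, hx, hy, hxy⟩ := hq
      refine ⟨hR, hS.attachTo x y, fun u v h1 h2 h3 h4 => ?_⟩
      by_contra huv
      have hux : u ≠ x := by
        rintro rfl
        exact huv (hx v h1 h2).symm
      have hvx : v ≠ x := by
        rintro rfl
        exact huv (hx u h2 h1)
      simp only [attachTo, hux, hvx, if_false] at h3 h4
      exact huv (hRS u v h1 h2 h3 h4)
    · rintro ⟨⟨R, S⟩, x, y⟩ hq ⟨⟨R', S'⟩, x', y'⟩ hq' h
      simp only [coe_sigma, Set.mem_sigma_iff, mem_coe, A, mem_filter, mem_labelled,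
        mem_offDiag, mem_singles] at hq hq'
      simp only [Prod.mk.injEq, Fin.mk.injEq] at h
      obtain ⟨⟨rfl, hSS⟩, hh, ha, hlt⟩ := h
      obtain ⟨⟨⟨hR, hS, hRS⟩, hd, hb⟩, hx, hy, hxy⟩ := hq
      obtain ⟨⟨⟨hR', hS', hRS'⟩, hd', hb'⟩, hx', hy', hxy'⟩ := hq'
      have hyy : S' y' y' := by simpa using hS'.2 y' y'
      have hpair : (x' = x ∧ y' = y) ∨ (x' = y ∧ y' = x) := by
        apply eq_or_eq_of_attach hd hy hx' hy' hxy' <;> rw [hSS] <;>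
          simpa [attachTo, Ne.symm hxy'] using hyy
      obtain ⟨rfl, rfl⟩ | ⟨rfl, rfl⟩ := hpair
      · have := attach_injective hS hS' hSS hh (iff_of_eq ha)
        simp only at this
        rw [this]
      · have := iff_of_eq hlt
        exfalso
        rcases lt_or_gt_of_ne hxy with h | h
        · exact lt_asymm h (this.1 h)
        · exact lt_asymm h (this.2 h)
  calc _ ≤ _ := h1
    _ ≤ _ := h2
    _ = _ := by
      rw [card_product]
      simp only [card_univ, Fintype.card_prod, Fintype.card_fin, Fintype.card_prop]
      ring

end Counting

section Labelling

open Classical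

/-- The matrices counted by `F1111 n`. -/
abbrev IncidenceMatrix (n : ℕ) : Type :=
  {A : Σ k l : ℕ, Matrix (Fin k) (Fin l) Bool // IsIncidence A.2.2 ∧ numOnes A.2.2 = n}

/-- The positions of the ones of a matrix. -/
abbrev Ones (A : Σ k l : ℕ, Matrix (Fin k) (Fin l) Bool) : Type :=
  {p : Fin A.1 × Fin A.2.1 // A.2.2 p.1 p.2 = true}

lemma card_ones (A : Σ k l : ℕ, Matrix (Fin k) (Fin l) Bool) :
    Fintype.card (Ones A) = numOnes A.2.2 := by
  rw [numOnes, Fintype.card_subtype]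

noncomputable def sigmaLabelEquiv (n : ℕ) :
    (Σ A : IncidenceMatrix n, Fin n ≃ Ones A.1) ≃ IncidenceMatrix n × Equiv.Perm (Fin n) :=
  (Equiv.sigmaCongrRight fun A => Equiv.equivCongr (Equiv.refl _)
    (Fintype.equivFinOfCardEq ((card_ones A.1).trans A.2.2))).trans (Equiv.sigmaEquivProd _ _)

/-- The two weak orders on the labels of the ones of a labelled matrix. -/
def orders {n : ℕ} (T : Σ A : IncidenceMatrix n, Fin n ≃ Ones A.1) :
    (Fin n → Fin n → Prop) × (Fin n → Fin n → Prop) :=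
  (fun x y => (T.2 x).1.1 ≤ (T.2 y).1.1, fun x y => (T.2 x).1.2 ≤ (T.2 y).1.2)

lemma isLabelledIncidence_orders {n : ℕ} (T : Σ A : IncidenceMatrix n, Fin n ≃ Ones A.1) :
    IsLabelledIncidence (orders T) := by
  refine ⟨⟨fun _ _ _ => le_trans, fun _ _ => le_total _ _⟩,
    ⟨fun _ _ _ => le_trans, fun _ _ => le_total _ _⟩, fun x y h1 h2 h3 h4 => ?_⟩
  exact T.2.injective (Subtype.ext (Prod.ext (le_antisymm h1 h2) (le_antisymm h3 h4)))

lemma val_le_of_surjective {α : Type*} {k l : ℕ} {f : α → Fin k} {g : α → Fin l}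
    (hf : Function.Surjective f) (h : ∀ x y, f x ≤ f y ↔ g x ≤ g y) (m : ℕ) :
    ∀ x, (f x : ℕ) = m → m ≤ g x := by
  induction m with
  | zero => simp
  | succ m ih =>
    intro x hx
    obtain ⟨y, hy⟩ := hf ⟨m, by have := (f x).2; omega⟩
    have h1 := ih y (by simp [hy])
    have h2 : ¬ g x ≤ g y := by
      rw [← h, Fin.le_def, hx, hy]
      simp
    rw [Fin.le_def] at h2
    omega

lemma le_of_surjective {α : Type*} {k l : ℕ} {f : α → Fin k} {g : α → Fin l}
    (hf : Function.Surjective f) (h : ∀ x y, f x ≤ f y ↔ g x ≤ g y) : k ≤ l := by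
  rcases k with _ | k
  · simp
  · obtain ⟨x, hx⟩ := hf (Fin.last k)
    have := val_le_of_surjective hf h k x (by simp [hx])
    have := (g x).2
    omega

lemma eq_of_surjective {α : Type*} {k : ℕ} {f g : α → Fin k}
    (hf : Function.Surjective f) (hg : Function.Surjective g)
    (h : ∀ x y, f x ≤ f y ↔ g x ≤ g y) : f = g := by
  funext x
  exact Fin.ext (le_antisymm (val_le_of_surjective hf h _ x rfl)
    (val_le_of_surjective hg (fun x y => (h x y).symm) _ x rfl))

lemma surjective_row {n : ℕ} (T : Σ A : IncidenceMatrix n, Fin n ≃ Ones A.1) :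
    Function.Surjective fun x => (T.2 x).1.1 := by
  intro i
  obtain ⟨j, hj⟩ := T.1.2.1.1 i
  exact ⟨T.2.symm ⟨(i, j), hj⟩, by simp⟩

lemma surjective_col {n : ℕ} (T : Σ A : IncidenceMatrix n, Fin n ≃ Ones A.1) :
    Function.Surjective fun x => (T.2 x).1.2 := by
  intro j
  obtain ⟨i, hi⟩ := T.1.2.1.2 j
  exact ⟨T.2.symm ⟨(i, j), hi⟩, by simp⟩

lemma orders_injective (n : ℕ) : Function.Injective (orders (n := n)) := by
  intro T T' h
  have hr : ∀ x y, (T.2 x).1.1 ≤ (T.2 y).1.1 ↔ (T'.2 x).1.1 ≤ (T'.2 y).1.1 := fun x y =>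
    iff_of_eq (congrFun (congrFun (congrArg Prod.fst h) x) y)
  have hc : ∀ x y, (T.2 x).1.2 ≤ (T.2 y).1.2 ↔ (T'.2 x).1.2 ≤ (T'.2 y).1.2 := fun x y =>
    iff_of_eq (congrFun (congrFun (congrArg Prod.snd h) x) y)
  have r := surjective_row T
  have r' := surjective_row T'
  have c := surjective_col T
  have c' := surjective_col T'
  have hk := le_antisymm (le_of_surjective r hr) (le_of_surjective r' fun x y => (hr x y).symm)
  have hl := le_antisymm (le_of_surjective c hc) (le_of_surjective c' fun x y => (hc x y).symm)
  obtain ⟨⟨⟨k, l, M⟩, hM⟩, σ⟩ := T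
  obtain ⟨⟨⟨k', l', M'⟩, hM'⟩, σ'⟩ := T'
  dsimp only at hk hl
  subst hk hl
  have hf := eq_of_surjective r r' hr
  have hg := eq_of_surjective c c' hc
  have hσ : ∀ x, (σ x).1 = (σ' x).1 := fun x => Prod.ext (congrFun hf x) (congrFun hg x)
  have hMM : M = M' := by
    ext i j
    rw [Bool.eq_iff_iff]
    constructor
    · intro hij
      have := (σ' (σ.symm ⟨(i, j), hij⟩)).2
      rw [← hσ] at this
      simpa using this
    · intro hij
      have := (σ (σ'.symm ⟨(i, j), hij⟩)).2
      rw [hσ] at this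
      simpa using this
  subst hMM
  have : σ = σ' := Equiv.ext fun x => Subtype.ext (hσ x)
  rw [this]

lemma IsWeakOrder.exists_surjective {n : ℕ} {R : Fin n → Fin n → Prop} (hR : IsWeakOrder R) :
    ∃ (k : ℕ) (f : Fin n → Fin k), Function.Surjective f ∧ ∀ x y, f x ≤ f y ↔ R x y := by
  let c : Fin n → ℕ := fun x => (Finset.univ.filter fun u => R u x).card
  have hc : ∀ x y, c x ≤ c y ↔ R x y := by
    intro x y
    constructor
    · intro h
      by_contra hxy
      have hyx := (hR.2 x y).resolve_left hxy
      refine absurd h (not_le.2 (Finset.card_lt_card ?_))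
      rw [Finset.ssubset_iff_of_subset (fun u hu => by
        simp only [Finset.mem_filter, Finset.mem_univ, true_and] at hu ⊢
        exact hR.1 _ _ _ hu hyx)]
      exact ⟨x, by simpa using hR.2 x x, by simpa using hxy⟩
    · intro h
      apply Finset.card_le_card
      intro u hu
      simp only [Finset.mem_filter, Finset.mem_univ, true_and] at hu ⊢
      exact hR.1 _ _ _ hu h
  let e := (Finset.univ.image c).orderIsoOfFin rfl
  refine ⟨_, fun x => e.symm ⟨c x, Finset.mem_image_of_mem _ (Finset.mem_univ _)⟩, ?_, ?_⟩
  · intro i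
    obtain ⟨x, -, hx⟩ := Finset.mem_image.1 (e i).2
    exact ⟨x, by rw [OrderIso.symm_apply_eq]; exact Subtype.ext hx⟩
  · intro x y
    rw [OrderIso.le_iff_le, Subtype.mk_le_mk, hc]

lemma exists_orders_eq {n : ℕ} {p : (Fin n → Fin n → Prop) × (Fin n → Fin n → Prop)}
    (hp : IsLabelledIncidence p) : ∃ T, orders T = p := by
  obtain ⟨R, S⟩ := p
  obtain ⟨hR, hS, hRS⟩ := hp
  obtain ⟨k, f, hf, hfR⟩ := hR.exists_surjective
  obtain ⟨l, g, hg, hgS⟩ := hS.exists_surjective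
  let A : Σ k l : ℕ, Matrix (Fin k) (Fin l) Bool :=
    ⟨k, l, fun i j => decide (∃ x, f x = i ∧ g x = j)⟩
  let φ : Fin n → Ones A := fun x => ⟨(f x, g x), by simpa [A] using ⟨x, rfl, rfl⟩⟩
  have hφ : Function.Bijective φ := by
    constructor
    · intro x y hxy
      have h1 : f x = f y := congrArg (fun q => q.1.1) hxy
      have h2 : g x = g y := congrArg (fun q => q.1.2) hxy
      exact hRS x y ((hfR _ _).1 h1.le) ((hfR _ _).1 h1.ge) ((hgS _ _).1 h2.le)
        ((hgS _ _).1 h2.ge)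
    · rintro ⟨⟨i, j⟩, hij⟩
      obtain ⟨x, rfl, rfl⟩ := of_decide_eq_true hij
      exact ⟨x, rfl⟩
  have hA : IsIncidence A.2.2 ∧ numOnes A.2.2 = n := by
    refine ⟨⟨fun i => ?_, fun j => ?_⟩, ?_⟩
    · obtain ⟨x, rfl⟩ := hf i
      exact ⟨g x, decide_eq_true ⟨x, rfl, rfl⟩⟩
    · obtain ⟨x, rfl⟩ := hg j
      exact ⟨f x, decide_eq_true ⟨x, rfl, rfl⟩⟩
    · rw [← card_ones, ← Fintype.card_of_bijective hφ, Fintype.card_fin]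
  refine ⟨⟨⟨A, hA⟩, Equiv.ofBijective φ hφ⟩, ?_⟩
  refine Prod.ext ?_ ?_
  · funext x y
    exact propext (hfR x y)
  · funext x y
    exact propext (hgS x y)

lemma F1111_mul_factorial (n : ℕ) : F1111 n * n.factorial = (labelled n).card := by
  have h1 : Nat.card (Σ A : IncidenceMatrix n, Fin n ≃ Ones A.1) = F1111 n * n.factorial := by
    rw [Nat.card_congr (sigmaLabelEquiv n), Nat.card_prod, Nat.card_perm, Nat.card_fin]
    rfl
  let Ψ : (Σ A : IncidenceMatrix n, Fin n ≃ Ones A.1) → labelled n :=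
    fun T => ⟨orders T, mem_labelled.2 (isLabelledIncidence_orders T)⟩
  have hΨ : Function.Bijective Ψ := by
    refine ⟨fun T T' h => orders_injective n (congrArg Subtype.val h), fun p => ?_⟩
    obtain ⟨T, hT⟩ := exists_orders_eq (mem_labelled.1 p.2)
    exact ⟨T, Subtype.ext hT⟩
  rw [← h1, Nat.card_congr (Equiv.ofBijective Ψ hΨ), Nat.card_eq_fintype_card, Fintype.card_coe]

lemma distinctUnitRows_orders {n : ℕ} (T : Σ A : IncidenceMatrix n, Fin n ≃ Ones A.1)
    (hT : ∀ i i' : Fin T.1.1.1, (∀ j, T.1.1.2.2 i j = T.1.1.2.2 i' j) → i = i') :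
    DistinctUnitRows (orders T) := by
  have key : ∀ x, Alone (orders T).1 x →
      ∀ j, T.1.1.2.2 (T.2 x).1.1 j = true ↔ j = (T.2 x).1.2 := by
    intro x hx j
    constructor
    · intro hj
      have := hx (T.2.symm ⟨((T.2 x).1.1, j), hj⟩) (by simp [orders]) (by simp [orders])
      rw [← this]
      simp
    · rintro rfl
      exact (T.2 x).2
  intro x y hx hy h1 h2
  have hcol : (T.2 x).1.2 = (T.2 y).1.2 := le_antisymm h1 h2
  have hrow : (T.2 x).1.1 = (T.2 y).1.1 := by
    apply hT
    intro j
    rw [Bool.eq_iff_iff, key x hx, key y hy, hcol]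
  exact T.2.injective (Subtype.ext (Prod.ext hrow hcol))

lemma F1011_mul_factorial_le (n : ℕ) :
    F1011 n * n.factorial ≤ ((labelled n).filter DistinctUnitRows).card := by
  let Y := {A : Σ k l : ℕ, Matrix (Fin k) (Fin l) Bool //
    IsIncidence A.2.2 ∧ numOnes A.2.2 = n ∧
    ∀ i i' : Fin A.1, (∀ j, A.2.2 i j = A.2.2 i' j) → i = i'}
  have h1 : Nat.card (Y × Equiv.Perm (Fin n)) = F1011 n * n.factorial := by
    rw [Nat.card_prod, Nat.card_perm, Nat.card_fin]
    rfl
  let L : Y × Equiv.Perm (Fin n) → Σ A : IncidenceMatrix n, Fin n ≃ Ones A.1 :=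
    fun q => (sigmaLabelEquiv n).symm (⟨q.1.1, q.1.2.1, q.1.2.2.1⟩, q.2)
  have hL : Function.Injective L := by
    rintro ⟨⟨A, hA⟩, π⟩ ⟨⟨A', hA'⟩, π'⟩ h
    have := (sigmaLabelEquiv n).symm.injective h
    simp only [Prod.mk.injEq, Subtype.mk.injEq] at this
    exact Prod.ext (Subtype.ext this.1) this.2
  let Ψ : Y × Equiv.Perm (Fin n) → (labelled n).filter DistinctUnitRows :=
    fun q => ⟨orders (L q), Finset.mem_filter.2
      ⟨mem_labelled.2 (isLabelledIncidence_orders _), distinctUnitRows_orders _ q.1.2.2.2⟩⟩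
  have hΨ : Function.Injective Ψ := fun q q' h =>
    hL (orders_injective n (congrArg Subtype.val h))
  rw [← h1]
  refine (Nat.card_le_card_of_injective Ψ hΨ).trans ?_
  rw [Nat.card_eq_fintype_card, Fintype.card_coe]

end Labelling

lemma F1011_div_F1111_le {n b : ℕ} (hb : 0 < b) (hbn : b < n) :
    (F1011 n : ℝ) / (F1111 n : ℝ) ≤ (b + 2) / (n - b) + 4 * n / (b * b) := by
  classical
  have hn : (0 : ℝ) < n - b := sub_pos.2 (by exact_mod_cast hbn)
  have hb' : (0 : ℝ) < b := by exact_mod_cast hb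
  rcases Nat.eq_zero_or_pos (F1111 n) with h0 | hpos
  · rw [h0, Nat.cast_zero, div_zero]
    positivity
  set L := (labelled n).card
  set N := ((labelled n).filter fun p => (singles p.1).card ≤ b).card
  set N' := ((labelled n).filter fun p => DistinctUnitRows p ∧ b < (singles p.1).card).card
  have hle : F1011 n * n.factorial ≤ N + N' := by
    refine (F1011_mul_factorial_le n).trans (le_trans (Finset.card_le_card ?_)
      (Finset.card_union_le _ _))
    intro p hp
    simp only [Finset.mem_filter, Finset.mem_union] at hp ⊢
    rcases le_or_gt (singles p.1).card b with h | h
    · exact Or.inl ⟨hp.1, h⟩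
    · exact Or.inr ⟨hp.1, hp.2, h⟩
  have hN : (N : ℝ) ≤ L * ((b + 2) / (n - b)) := by
    rw [← mul_div_assoc, le_div_iff₀ hn, ← Nat.cast_sub hbn.le]
    exact_mod_cast card_few_singles_mul_le n b
  have hN' : (N' : ℝ) ≤ L * (4 * n / (b * b)) := by
    rw [← mul_div_assoc, le_div_iff₀ (by positivity)]
    exact_mod_cast card_many_singles_mul_le n b
  have hL : (F1111 n : ℝ) * n.factorial = L := by exact_mod_cast F1111_mul_factorial n
  have hle' : (F1011 n : ℝ) * n.factorial ≤ N + N' := by exact_mod_cast hle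
  have hfac : (0 : ℝ) < n.factorial := by exact_mod_cast n.factorial_pos
  rw [div_le_iff₀ (by exact_mod_cast hpos)]
  refine le_of_mul_le_mul_right ?_ hfac
  rw [mul_assoc, hL]
  linarith

lemma F1011_div_F1111_le_of_le {n t : ℕ} (ht : 2 ≤ t) (htn : t ≤ n) :
    (F1011 n : ℝ) / (F1111 n : ℝ) ≤ 2 / t + (4 + 16 * t ^ 2) / n := by
  have hb : 0 < n / t := Nat.div_pos htn (by omega)
  have hbn : n / t < n := Nat.div_lt_self (by omega) ht
  refine (F1011_div_F1111_le hb hbn).trans ?_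
  have h1 : n / t * t ≤ n := Nat.div_mul_le_self n t
  have h2 : n < t * (n / t + 1) := Nat.lt_mul_div_succ n (by omega)
  generalize n / t = b at *
  have ht' : (2 : ℝ) ≤ t := by exact_mod_cast ht
  have hn' : (0 : ℝ) < n := by exact_mod_cast (by omega : 0 < n)
  have hb' : (1 : ℝ) ≤ b := by exact_mod_cast hb
  have h1' : (b : ℝ) * t ≤ n := by exact_mod_cast h1
  have h2' : (n : ℝ) ≤ t * (b + 1) := by exact_mod_cast h2.le
  have hhalf : (n : ℝ) / 2 ≤ n - b := by nlinarith
  have hlow : (n : ℝ) ≤ 2 * t * b := by nlinarith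
  have e1 : ((b : ℝ) + 2) / (n - b) ≤ 2 / t + 4 / n := by
    have hbt : (b : ℝ) ≤ n / t := by rwa [le_div_iff₀ (by linarith)]
    calc ((b : ℝ) + 2) / (n - b) ≤ (n / t + 2) / (n / 2) := by gcongr
      _ = 2 / t + 4 / n := by field_simp; ring
  have e2 : 4 * (n : ℝ) / (b * b) ≤ 16 * t ^ 2 / n := by
    rw [div_le_div_iff₀ (by positivity) hn']
    nlinarith [mul_self_le_mul_self hn'.le hlow]
  rw [add_div (4 : ℝ)]
  linarith

/-- `F₁₀₁₁(n) = o(F₁₁₁₁(n))` as `n → ∞`. -/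
theorem F1011_little_o :
    Filter.Tendsto (fun n : ℕ => (F1011 n : ℝ) / (F1111 n : ℝ))
      Filter.atTop (nhds 0) := by
  rw [Metric.tendsto_nhds]
  intro ε hε
  obtain ⟨t, ht2, ht⟩ : ∃ t : ℕ, 2 ≤ t ∧ (2 : ℝ) / t < ε / 2 :=
    ((Filter.eventually_ge_atTop 2).and
      ((tendsto_const_div_atTop_nhds_zero_nat 2).eventually_lt_const (half_pos hε))).exists
  filter_upwards [Filter.eventually_ge_atTop t,
    (tendsto_const_div_atTop_nhds_zero_nat (4 + 16 * (t : ℝ) ^ 2)).eventually_lt_const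
      (half_pos hε)] with n hn hlt
  rw [Real.dist_0_eq_abs, abs_of_nonneg (by positivity)]
  linarith [F1011_div_F1111_le_of_le ht2 hn]
end
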